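/- Let R = Z_p[[T]] be the ring of formal power series over Z_p, and set x = 1 + T (a unit of R). For t ≥ 0 define u_t = x^{−⌈t/2⌉} T^t ∈ R. Then for every r ≥ 0 the family {u_t}_{t ≥ r} is Z_p-linearly independent and the closure of its Z_p-span in R (with the product topology / (p,T)-adic topology) is the ideal (T^r). Moreover {u_0, …, u_r} is a Z_p-basis of Σ_{i=−⌈r/2⌉}^{⌊r/2⌋} Z_p x^i. -/

import Mathlib

/-- The product ("coefficientwise") topology on `ℤ_p[[T]]`, each coefficient carrying the
`p`-adic topology.  This is the topology of `ℤ_p[[T]] = lim (ℤ/pᵐ)[T]/(Tⁿ)`. -/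
noncomputable instance powerSeriesTopology (p : ℕ) [Fact p.Prime] :
    TopologicalSpace (PowerSeries ℤ_[p]) :=
  inferInstanceAs (TopologicalSpace ((Unit →₀ ℕ) → ℤ_[p]))

/-- `u_t = x^{-⌈t/2⌉} T^t`, where `x = 1 + T`. -/
noncomputable def upow {p : ℕ} [Fact p.Prime]
    (hx : IsUnit (1 + PowerSeries.X : PowerSeries ℤ_[p])) (t : ℕ) : PowerSeries ℤ_[p] :=
  ((hx.unit⁻¹ : (PowerSeries ℤ_[p])ˣ) : PowerSeries ℤ_[p]) ^ ((t + 1) / 2) *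
    PowerSeries.X ^ t

/-- The span of the powers `xⁱ` of a unit with `a ≤ i ≤ b`. -/
def zpowSpan (R : Type*) {A : Type*} [CommRing R] [CommRing A] [Algebra R A] (x : Aˣ)
    (a b : ℤ) : Submodule R A :=
  Submodule.span R {y : A | ∃ i : ℤ, a ≤ i ∧ i ≤ b ∧ y = ((x ^ i : Aˣ) : A)}

section ZPowSpan

variable {R A : Type*} [CommRing R] [CommRing A] [Algebra R A] (x : Aˣ)

theorem zpow_mem_zpowSpan {a b i : ℤ} (ha : a ≤ i) (hb : i ≤ b) :
    ((x ^ i : Aˣ) : A) ∈ zpowSpan R x a b :=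
  Submodule.subset_span ⟨i, ha, hb, rfl⟩

theorem zpowSpan_mono {a b a' b' : ℤ} (ha : a' ≤ a) (hb : b ≤ b') :
    zpowSpan R x a b ≤ zpowSpan R x a' b' :=
  Submodule.span_mono fun _ ⟨i, h₁, h₂, h⟩ => ⟨i, ha.trans h₁, h₂.trans hb, h⟩

/-- The top-degree term of `xᵐ (x - 1)ⁿ` is `xᵐ⁺ⁿ`. -/
theorem zpow_mul_sub_one_pow_sub_top_mem (n : ℕ) (m : ℤ) :
    ((x ^ m : Aˣ) : A) * ((x : A) - 1) ^ n - ((x ^ (m + n) : Aˣ) : A) ∈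
      zpowSpan R x m (m + n - 1) := by
  induction n generalizing m with
  | zero => simp
  | succ n ih =>
    have h₁ := zpowSpan_mono (R := R) x (a' := m) (b' := m + n) (by lia) (by lia) (ih (m + 1))
    have h₂ := zpowSpan_mono (R := R) x (a' := m) (b' := m + n) (by lia) (by lia) (ih m)
    have h₃ := zpow_mem_zpowSpan (R := R) x (a := m) (b := m + n) (i := m + n)
      (by lia) (by lia)
    have h := sub_mem (sub_mem h₁ h₂) h₃
    rw [show m + ((n + 1 : ℕ) : ℤ) - 1 = m + n by push_cast; ring]
    convert h using 1
    rw [show m + ((n + 1 : ℕ) : ℤ) = m + 1 + n by push_cast; ring, zpow_add_one x m]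
    push_cast
    ring

/-- The bottom-degree term of `xᵐ (x - 1)ⁿ` is `(-1)ⁿ xᵐ`. -/
theorem zpow_mul_sub_one_pow_sub_bot_mem (n : ℕ) (m : ℤ) :
    ((x ^ m : Aˣ) : A) * ((x : A) - 1) ^ n - (-1) ^ n * ((x ^ m : Aˣ) : A) ∈
      zpowSpan R x (m + 1) (m + n) := by
  induction n generalizing m with
  | zero => simp
  | succ n ih =>
    have h₁ := zpowSpan_mono (R := R) x (a' := m + 1) (b' := m + (n + 1 : ℕ))
      (by lia) (by lia) (ih (m + 1))
    have h₂ := zpowSpan_mono (R := R) x (a' := m + 1) (b' := m + (n + 1 : ℕ))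
      (by lia) (by lia) (ih m)
    have h₃ := Submodule.smul_mem _ ((-1 : R) ^ n) (zpow_mem_zpowSpan (R := R) x
      (a := m + 1) (b := m + (n + 1 : ℕ)) (i := m + 1) (by lia) (by lia))
    have h := sub_mem (add_mem h₁ h₃) h₂
    convert h using 1
    rw [zpow_add_one x m, Algebra.smul_def]
    push_cast [map_pow, map_neg, map_one]
    ring

theorem zpowSpan_le_of_top {a b : ℤ} {N : Submodule R A} (h : zpowSpan R x a (b - 1) ≤ N)
    (hb : ((x ^ b : Aˣ) : A) ∈ N) : zpowSpan R x a b ≤ N := by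
  refine Submodule.span_le.2 ?_
  rintro _ ⟨i, h₁, h₂, rfl⟩
  rcases h₂.eq_or_lt with rfl | h₂
  · exact hb
  · exact h (zpow_mem_zpowSpan x h₁ (by lia))

theorem zpowSpan_le_of_bot {a b : ℤ} {N : Submodule R A} (h : zpowSpan R x (a + 1) b ≤ N)
    (ha : ((x ^ a : Aˣ) : A) ∈ N) : zpowSpan R x a b ≤ N := by
  refine Submodule.span_le.2 ?_
  rintro _ ⟨i, h₁, h₂, rfl⟩
  rcases h₁.eq_or_lt with rfl | h₁
  · exact ha
  · exact h (zpow_mem_zpowSpan x (by lia) h₂)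

/-- The elements `x^{-⌈t/2⌉} (x - 1)ᵗ`, `t ≤ r`, span the same module as the powers `xⁱ`,
`-⌈r/2⌉ ≤ i ≤ ⌊r/2⌋`. -/
theorem span_zpow_mul_sub_one_pow (r : ℕ) :
    Submodule.span R ((fun t : ℕ => ((x ^ (-(((t + 1) / 2 : ℕ) : ℤ)) : Aˣ) : A) *
        ((x : A) - 1) ^ t) '' {t : ℕ | t ≤ r}) =
      zpowSpan R x (-(((r + 1) / 2 : ℕ) : ℤ)) ((r / 2 : ℕ) : ℤ) := by
  set u : ℕ → A := fun t => ((x ^ (-(((t + 1) / 2 : ℕ) : ℤ)) : Aˣ) : A) * ((x : A) - 1) ^ t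
    with hu
  apply le_antisymm
  · refine Submodule.span_le.2 ?_
    rintro _ ⟨t, ht, rfl⟩
    have ht : t ≤ r := ht
    have h₁ := zpow_mul_sub_one_pow_sub_top_mem (R := R) x t (-(((t + 1) / 2 : ℕ) : ℤ))
    have h₂ := zpow_mem_zpowSpan (R := R) x (a := -(((r + 1) / 2 : ℕ) : ℤ))
      (b := ((r / 2 : ℕ) : ℤ)) (i := -(((t + 1) / 2 : ℕ) : ℤ) + t) (by lia) (by lia)
    have h₃ := add_mem (zpowSpan_mono (R := R) x (a' := -(((r + 1) / 2 : ℕ) : ℤ))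
      (b' := ((r / 2 : ℕ) : ℤ)) (by lia) (by lia) h₁) h₂
    simpa [hu] using h₃
  · induction r with
    | zero =>
      refine Submodule.span_le.2 ?_
      rintro _ ⟨i, h₁, h₂, rfl⟩
      obtain rfl : i = 0 := by simp at h₁ h₂; lia
      exact Submodule.subset_span ⟨0, by simp, by simp [hu]⟩
    | succ r ih =>
      have hle : zpowSpan R x (-(((r + 1) / 2 : ℕ) : ℤ)) ((r / 2 : ℕ) : ℤ) ≤
          Submodule.span R (u '' {t : ℕ | t ≤ r + 1}) :=
        ih.trans (Submodule.span_mono (Set.image_mono fun t (ht : t ≤ r) => ht.trans r.le_succ))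
      have hmem : u (r + 1) ∈ Submodule.span R (u '' {t : ℕ | t ≤ r + 1}) :=
        Submodule.subset_span ⟨r + 1, le_refl (r + 1), rfl⟩
      rcases Nat.even_or_odd r with hr | hr
      · have hr2 := Nat.even_iff.1 hr
        have key := zpow_mul_sub_one_pow_sub_bot_mem (R := R) x (r + 1)
          (-(((r + 1 + 1) / 2 : ℕ) : ℤ))
        have hk := hle (zpowSpan_mono x (by lia) (by lia) key)
        refine zpowSpan_le_of_bot x ((zpowSpan_mono x (by lia) (by lia)).trans hle) ?_
        have h := sub_mem hk hmem
        rw [(Even.add_one hr).neg_one_pow] at h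
        simpa [hu] using h
      · have hr2 := Nat.odd_iff.1 hr
        have key := zpow_mul_sub_one_pow_sub_top_mem (R := R) x (r + 1)
          (-(((r + 1 + 1) / 2 : ℕ) : ℤ))
        rw [show -(((r + 1 + 1) / 2 : ℕ) : ℤ) + ((r + 1 : ℕ) : ℤ) = (((r + 1) / 2 : ℕ) : ℤ) by
          lia] at key
        have hk := hle (zpowSpan_mono x (by lia) (by lia) key)
        refine zpowSpan_le_of_top x ((zpowSpan_mono x (by lia) (by lia)).trans hle) ?_
        have h := sub_mem hmem hk
        simpa [hu] using h

end ZPowSpan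

section UpperTriangular

open PowerSeries

variable {R : Type*} [CommRing R] {u : ℕ → PowerSeries R}

/-- A family of power series `u_t ∈ Tᵗ + (Tᵗ⁺¹)` is linearly independent. -/
theorem linearIndependent_of_coeff_eq_one (hlt : ∀ t n, n < t → coeff n (u t) = 0)
    (hone : ∀ t, coeff t (u t) = 1) : LinearIndependent R u := by
  rw [linearIndependent_iff']
  intro s g hg i
  induction i using Nat.strong_induction_on with
  | _ i ih =>
    intro hi
    have h := congrArg (coeff i) hg
    rw [map_sum, Finset.sum_eq_single i] at h
    · simpa [hone] using h
    · intro j hj hji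
      rcases hji.lt_or_gt with hji | hji
      · simp [ih j hji hj]
      · simp [hlt j i hji]
    · exact fun h => absurd hi h

/-- Every element of `(Tʳ)` is congruent modulo `(Tʳ⁺ⁿ)` to a combination of the `u_t`,
`t ≥ r`. -/
theorem exists_mem_span_coeff_eq (hlt : ∀ t n, n < t → coeff n (u t) = 0)
    (hone : ∀ t, coeff t (u t) = 1) {r : ℕ} {f : PowerSeries R}
    (hf : ∀ m < r, coeff m f = 0) (n : ℕ) :
    ∃ g ∈ Submodule.span R (u '' {t : ℕ | r ≤ t}), ∀ m < r + n, coeff m g = coeff m f := by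
  induction n with
  | zero => exact ⟨0, zero_mem _, fun m hm => by simp [hf m hm]⟩
  | succ n ih =>
    obtain ⟨g, hg, hgf⟩ := ih
    refine ⟨g + (coeff (r + n) f - coeff (r + n) g) • u (r + n), add_mem hg
      (Submodule.smul_mem _ _ (Submodule.subset_span ⟨r + n, Nat.le_add_right r n, rfl⟩)), ?_⟩
    intro m hm
    rcases (show m ≤ r + n by lia).eq_or_lt with rfl | hm
    · simp [hone]
    · simp [hgf m hm, hlt _ m hm]

end UpperTriangular

section PadicInt

variable {p : ℕ} [Fact p.Prime]

theorem continuous_coeff_powerSeries (n : ℕ) :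
    Continuous fun f : PowerSeries ℤ_[p] => PowerSeries.coeff n f :=
  PowerSeries.WithPiTopology.continuous_coeff ℤ_[p] n

theorem closure_span_eq_span_X_pow {u : ℕ → PowerSeries ℤ_[p]}
    (hlt : ∀ t n, n < t → PowerSeries.coeff n (u t) = 0)
    (hone : ∀ t, PowerSeries.coeff t (u t) = 1) (r : ℕ) :
    closure ((Submodule.span ℤ_[p] (u '' {t : ℕ | r ≤ t}) :
        Submodule ℤ_[p] (PowerSeries ℤ_[p])) : Set (PowerSeries ℤ_[p])) =
      ((Ideal.span {(PowerSeries.X : PowerSeries ℤ_[p]) ^ r} :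
        Ideal (PowerSeries ℤ_[p])) : Set (PowerSeries ℤ_[p])) := by
  have hmem (f : PowerSeries ℤ_[p]) :
      f ∈ ((Ideal.span {(PowerSeries.X : PowerSeries ℤ_[p]) ^ r} :
        Ideal (PowerSeries ℤ_[p])) : Set (PowerSeries ℤ_[p])) ↔
        ∀ m < r, PowerSeries.coeff m f = 0 := by
    rw [SetLike.mem_coe, Ideal.mem_span_singleton, PowerSeries.X_pow_dvd_iff]
  apply Set.Subset.antisymm
  · refine closure_minimal ?_ ?_
    · intro f hf
      rw [hmem]
      intro m hm
      have hle : Submodule.span ℤ_[p] (u '' {t : ℕ | r ≤ t}) ≤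
          LinearMap.ker (PowerSeries.coeff (R := ℤ_[p]) m) := by
        refine Submodule.span_le.2 ?_
        rintro _ ⟨t, ht, rfl⟩
        exact hlt t m (hm.trans_le ht)
      exact hle hf
    · rw [show ((Ideal.span {(PowerSeries.X : PowerSeries ℤ_[p]) ^ r} :
          Ideal (PowerSeries ℤ_[p])) : Set (PowerSeries ℤ_[p])) =
          ⋂ m, ⋂ (_ : m < r), {f | PowerSeries.coeff m f = 0} by
        ext f; rw [hmem]; simp]
      exact isClosed_iInter fun m => isClosed_iInter fun _ =>
        isClosed_eq (continuous_coeff_powerSeries m) continuous_const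
  · intro f hf
    choose g hg hgf using exists_mem_span_coeff_eq hlt hone ((hmem f).1 hf)
    refine mem_closure_of_tendsto (f := g) (b := Filter.atTop) ?_ (Filter.Eventually.of_forall hg)
    refine (PowerSeries.WithPiTopology.tendsto_iff_coeff_tendsto ℤ_[p] g Filter.atTop f).2 ?_
    intro d
    refine tendsto_const_nhds.congr' ?_
    filter_upwards [Filter.eventually_gt_atTop d] with n hn
    exact (hgf n d (by lia)).symm

variable (hx : IsUnit (1 + PowerSeries.X : PowerSeries ℤ_[p]))

theorem coeff_upow_of_lt (t n : ℕ) (h : n < t) : PowerSeries.coeff n (upow hx t) = 0 := by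
  rw [upow, PowerSeries.coeff_mul_X_pow', if_neg (by lia)]

theorem coeff_upow_self (t : ℕ) : PowerSeries.coeff t (upow hx t) = 1 := by
  have h : PowerSeries.constantCoeff ((hx.unit⁻¹ : (PowerSeries ℤ_[p])ˣ) : PowerSeries ℤ_[p])
      = 1 := by
    have := congrArg PowerSeries.constantCoeff hx.val_inv_mul
    rw [map_mul] at this
    simpa only [map_add, map_one, PowerSeries.constantCoeff_X, add_zero, mul_one] using this
  rw [upow, PowerSeries.coeff_mul_X_pow', if_pos le_rfl]
  simp [h]

theorem upow_eq_zpow_mul (t : ℕ) :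
    upow hx t = ((hx.unit ^ (-(((t + 1) / 2 : ℕ) : ℤ)) : (PowerSeries ℤ_[p])ˣ) :
      PowerSeries ℤ_[p]) * ((hx.unit : PowerSeries ℤ_[p]) - 1) ^ t := by
  rw [upow, zpow_neg, zpow_natCast, ← inv_pow, Units.val_pow_eq_pow_val, IsUnit.unit_spec,
    add_sub_cancel_left]

end PadicInt

/-- Let `R = ℤ_p[[T]]`, and `x = 1 + T ∈ Rˣ`.  For `t ≥ 0` put
`u_t = x^{-⌈t/2⌉} T^t`.  Then for every `r ≥ 0`:
(1) the family `{u_t}_{t ≥ r}` is `ℤ_p`-linearly independent;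
(2) the closure of its `ℤ_p`-span in `R` (product topology on coefficients) is the
    ideal `(T^r)`;
(3) `{u_0, …, u_r}` is a `ℤ_p`-basis of `Σ_{i = -⌈r/2⌉}^{⌊r/2⌋} ℤ_p xⁱ`. -/
theorem power_series_augmentation_basis (p : ℕ) [Fact p.Prime]
    (hx : IsUnit (1 + PowerSeries.X : PowerSeries ℤ_[p])) (r : ℕ) :
    -- (1)
    LinearIndependent ℤ_[p] (fun t : {t : ℕ // r ≤ t} => upow hx (t : ℕ)) ∧
    -- (2)
    closure ((Submodule.span ℤ_[p] (upow hx '' {t : ℕ | r ≤ t}) :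
        Submodule ℤ_[p] (PowerSeries ℤ_[p])) : Set (PowerSeries ℤ_[p])) =
      ((Ideal.span {(PowerSeries.X : PowerSeries ℤ_[p]) ^ r} :
        Ideal (PowerSeries ℤ_[p])) : Set (PowerSeries ℤ_[p])) ∧
    -- (3): `u_0, …, u_r` are independent and span `Σ_{i=-⌈r/2⌉}^{⌊r/2⌋} ℤ_p xⁱ`
    (LinearIndependent ℤ_[p] (fun t : Fin (r + 1) => upow hx (t : ℕ)) ∧
      Submodule.span ℤ_[p] (upow hx '' {t : ℕ | t ≤ r}) =
        Submodule.span ℤ_[p] {y : PowerSeries ℤ_[p] | ∃ i : ℤ,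
          -(((r + 1) / 2 : ℕ) : ℤ) ≤ i ∧ i ≤ ((r / 2 : ℕ) : ℤ) ∧
          y = ((hx.unit ^ i : (PowerSeries ℤ_[p])ˣ) : PowerSeries ℤ_[p])}) := by
  have hlt := coeff_upow_of_lt hx
  have hone := coeff_upow_self hx
  have hli := linearIndependent_of_coeff_eq_one hlt hone
  refine ⟨hli.comp _ Subtype.val_injective, closure_span_eq_span_X_pow hlt hone r,
    hli.comp _ Fin.val_injective, ?_⟩
  rw [show upow hx = _ from funext (upow_eq_zpow_mul hx)]
  exact span_zpow_mul_sub_one_pow hx.unit r
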